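/- Let d ≥ 1, 1 < p < ∞, δ ∈ ℝ, let m ≥ 0 be an integer with mp > d, and let k be a nonnegative integer with k < m − d/p. Then there exists a constant C = C(d,m,p,k,δ) such that every f ∈ C^m(ℝ^d) with ‖f‖_{W^{m,p}_{δ−d/p}} := Σ_{|α|≤m} ‖⟨x⟩^{δ−d/p+|α|} D^α f‖_{L^p(ℝ^d)} < ∞ satisfies, for every multi-index α with |α| ≤ k: (i) sup_{x∈ℝ^d} ⟨x⟩^{δ+|α|} |D^α f(x)| ≤ C · ‖f‖_{W^{m,p}_{δ−d/p}}, and (ii) |x|^{δ+|α|} |D^α f(x)| → 0 as |x| → ∞. -/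

import Mathlib

open MeasureTheory Filter
open scoped BigOperators ENNReal Topology

noncomputable section

/-- The Japanese bracket `⟨x⟩ = (1+|x|²)^{1/2}`. -/
def jb {d : ℕ} (x : EuclideanSpace ℝ (Fin d)) : ℝ := Real.sqrt (1 + ‖x‖ ^ 2)

/-- The partial derivative in the `i`-th coordinate direction. -/
def pd {d : ℕ} {F : Type*} [NormedAddCommGroup F] [NormedSpace ℝ F] (i : Fin d)
    (f : EuclideanSpace ℝ (Fin d) → F) : EuclideanSpace ℝ (Fin d) → F :=
  fun x => fderiv ℝ f x (EuclideanSpace.single i 1)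

/-- Iterated partial derivatives along a list of coordinate directions. -/
def pdList {d : ℕ} {F : Type*} [NormedAddCommGroup F] [NormedSpace ℝ F] :
    List (Fin d) → (EuclideanSpace ℝ (Fin d) → F) → EuclideanSpace ℝ (Fin d) → F
  | [], f => f
  | i :: l, f => pd i (pdList l f)

/-- The partial derivative `D^α f` corresponding to a multi-index `α : Fin d → ℕ`. -/
def mD {d : ℕ} {F : Type*} [NormedAddCommGroup F] [NormedSpace ℝ F] (α : Fin d → ℕ)
    (f : EuclideanSpace ℝ (Fin d) → F) : EuclideanSpace ℝ (Fin d) → F :=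
  pdList ((List.finRange d).flatMap fun i => List.replicate (α i) i) f

/-- The order `|α|` of a multi-index. -/
def msize {d : ℕ} (α : Fin d → ℕ) : ℕ := ∑ i, α i

/-- The finset of all multi-indices on `ℝ^d` of order at most `m`. -/
def mIdx (d m : ℕ) : Finset (Fin d → ℕ) :=
  (Fintype.piFinset fun _ : Fin d => Finset.range (m + 1)).filter fun α => msize α ≤ m

section PartialDerivatives

variable {d : ℕ}

theorem ContDiff.fderiv_apply_const {g : EuclideanSpace ℝ (Fin d) → ℝ} {n : ℕ}
    (hg : ContDiff ℝ (n + 1 : ℕ) g) (v : EuclideanSpace ℝ (Fin d)) :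
    ContDiff ℝ n fun x => fderiv ℝ g x v :=
  (hg.fderiv_right (m := n) (by norm_cast)).clm_apply contDiff_const

theorem contDiff_pdList (l : List (Fin d)) {f : EuclideanSpace ℝ (Fin d) → ℝ} {n : ℕ}
    (hf : ContDiff ℝ (n + l.length : ℕ) f) : ContDiff ℝ n (pdList l f) := by
  induction l generalizing n with
  | nil => exact hf
  | cons i l ih =>
    refine ContDiff.fderiv_apply_const (ih ?_) _
    convert hf using 2
    simp; ring

theorem pd_comm {g : EuclideanSpace ℝ (Fin d) → ℝ} (hg : ContDiff ℝ 2 g) (i j : Fin d) :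
    pd i (pd j g) = pd j (pd i g) := by
  have key : ∀ (a b : Fin d) (x : EuclideanSpace ℝ (Fin d)), pd a (pd b g) x =
      fderiv ℝ (fderiv ℝ g) x (EuclideanSpace.single a 1) (EuclideanSpace.single b 1) := by
    intro a b x
    have hd : DifferentiableAt ℝ (fderiv ℝ g) x :=
      (hg.fderiv_right (m := 1) (by norm_num)).differentiable (by norm_num) x
    unfold pd
    rw [fderiv_clm_apply hd (differentiableAt_const _)]
    simp
  funext x
  rw [key, key]
  exact (hg.contDiffAt.isSymmSndFDerivAt (by simp)).eq _ _

theorem pdList_perm {l l' : List (Fin d)} (h : l.Perm l') {f : EuclideanSpace ℝ (Fin d) → ℝ}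
    (hf : ContDiff ℝ l.length f) : pdList l f = pdList l' f := by
  induction h with
  | nil => rfl
  | cons i _ ih =>
    simp only [pdList]
    rw [ih (hf.of_le (by simp))]
  | swap i j l =>
    refine pd_comm (contDiff_pdList (n := 2) l ?_) _ _
    convert hf using 2
    simp; ring
  | trans h₁ _ ih₁ ih₂ =>
    rw [ih₁ hf, ih₂ (by rwa [← h₁.length_eq])]

theorem length_flatMap_replicate (α : Fin d → ℕ) :
    ((List.finRange d).flatMap fun i => List.replicate (α i) i).length = msize α := by
  simp [List.length_flatMap, msize, Fin.sum_univ_def]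

theorem count_flatMap_replicate (α : Fin d → ℕ) (j : Fin d) :
    ((List.finRange d).flatMap fun i => List.replicate (α i) i).count j = α j := by
  rw [List.count_flatMap, ← Fin.sum_univ_def]
  simp [List.count_replicate]

theorem contDiff_mD (α : Fin d → ℕ) {f : EuclideanSpace ℝ (Fin d) → ℝ} {n : ℕ}
    (hf : ContDiff ℝ (n + msize α : ℕ) f) : ContDiff ℝ n (mD α f) :=
  contDiff_pdList _ (by rwa [length_flatMap_replicate])

theorem msize_add_single (α : Fin d → ℕ) (i : Fin d) :
    msize (α + Pi.single i 1) = msize α + 1 := by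
  simp [msize, Finset.sum_add_distrib]

theorem mem_mIdx {m : ℕ} {α : Fin d → ℕ} : α ∈ mIdx d m ↔ msize α ≤ m := by
  simp only [mIdx, Finset.mem_filter, Fintype.mem_piFinset, Finset.mem_range,
    and_iff_right_iff_imp]
  intro h i
  have : α i ≤ msize α :=
    Finset.single_le_sum (f := α) (fun _ _ => Nat.zero_le _) (Finset.mem_univ i)
  omega

theorem pd_mD (α : Fin d → ℕ) (i : Fin d) {f : EuclideanSpace ℝ (Fin d) → ℝ}
    (hf : ContDiff ℝ (msize α + 1 : ℕ) f) : pd i (mD α f) = mD (α + Pi.single i 1) f := by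
  refine pdList_perm (l := i :: _) (List.perm_iff_count.2 fun j => ?_) ?_
  · rw [List.count_cons, count_flatMap_replicate, count_flatMap_replicate]
    by_cases h : i = j
    · subst h; simp
    · simp [h, Ne.symm h]
  · simpa only [List.length_cons, length_flatMap_replicate] using hf

theorem fderiv_apply_eq_sum_pd (g : EuclideanSpace ℝ (Fin d) → ℝ)
    (y v : EuclideanSpace ℝ (Fin d)) : fderiv ℝ g y v = ∑ i, v i * pd i g y := by
  have hv : v = ∑ i, v i • EuclideanSpace.single i (1 : ℝ) := by
    ext j
    simp [Pi.single_apply]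
  conv_lhs => rw [hv]
  simp [pd]

/-- The derivative of `g` in the constant direction `v`. -/
def dirDeriv (v : EuclideanSpace ℝ (Fin d)) (g : EuclideanSpace ℝ (Fin d) → ℝ) :
    EuclideanSpace ℝ (Fin d) → ℝ :=
  fun x => fderiv ℝ g x v

theorem contDiff_iterate_dirDeriv (v : EuclideanSpace ℝ (Fin d)) (j : ℕ) {n : ℕ}
    {g : EuclideanSpace ℝ (Fin d) → ℝ} (hg : ContDiff ℝ (n + j : ℕ) g) :
    ContDiff ℝ n ((dirDeriv v)^[j] g) := by
  induction j generalizing g with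
  | zero => simpa using hg
  | succ j ih =>
    exact ih (ContDiff.fderiv_apply_const (by simpa only [add_assoc] using hg) v)

theorem iterate_dirDeriv_sum (v : EuclideanSpace ℝ (Fin d)) (j : ℕ)
    {c : Fin d → ℝ} {g : Fin d → EuclideanSpace ℝ (Fin d) → ℝ} (hg : ∀ i, ContDiff ℝ j (g i)) :
    (dirDeriv v)^[j] (fun y => ∑ i, c i * g i y) =
      fun y => ∑ i, c i * (dirDeriv v)^[j] (g i) y := by
  induction j generalizing g with
  | zero => rfl
  | succ j ih =>
    have h : dirDeriv v (fun y => ∑ i, c i * g i y) = fun y => ∑ i, c i * dirDeriv v (g i) y := by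
      funext y
      have hd : ∀ i, DifferentiableAt ℝ (g i) y := fun i =>
        (hg i).differentiable (by simp) y
      unfold dirDeriv
      rw [fderiv_fun_sum fun i _ => (hd i).const_mul (c i)]
      simp [fderiv_const_mul, hd]
    rw [Function.iterate_succ_apply, h,
      ih (g := fun i => dirDeriv v (g i)) fun i => ContDiff.fderiv_apply_const (hg i) v]
    rfl

theorem abs_iterate_dirDeriv_mD_le {m : ℕ} {f : EuclideanSpace ℝ (Fin d) → ℝ}
    (hf : ContDiff ℝ m f) (v y : EuclideanSpace ℝ (Fin d)) (j : ℕ) (α : Fin d → ℕ)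
    (hα : msize α + j ≤ m) :
    |(dirDeriv v)^[j] (mD α f) y| ≤
      (d : ℝ) ^ j * ∑ β ∈ mIdx d m with msize β = msize α + j, ‖v‖ ^ j * |mD β f y| := by
  induction j generalizing α with
  | zero =>
    have : α ∈ (mIdx d m).filter (fun β => msize β = msize α + 0) := by
      simp [mem_mIdx]; omega
    simpa using Finset.single_le_sum (f := fun β => |mD β f y|) (fun _ _ => abs_nonneg _) this
  | succ j ih =>
    have h1 : dirDeriv v (mD α f) = fun y => ∑ i, v i * mD (α + Pi.single i 1) f y := by
      funext y
      rw [dirDeriv, fderiv_apply_eq_sum_pd]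
      simp_rw [pd_mD α _ (hf.of_le (by norm_cast; omega) : ContDiff ℝ (msize α + 1 : ℕ) f)]
    rw [Function.iterate_succ_apply, h1, iterate_dirDeriv_sum]
    · calc |∑ i, v i * (dirDeriv v)^[j] (mD (α + Pi.single i 1) f) y|
          ≤ ∑ i, |v i * (dirDeriv v)^[j] (mD (α + Pi.single i 1) f) y| :=
            Finset.abs_sum_le_sum_abs _ _
        _ ≤ ∑ _i : Fin d, (d : ℝ) ^ j *
            ∑ β ∈ mIdx d m with msize β = msize α + (j + 1), ‖v‖ ^ (j + 1) * |mD β f y| := by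
          refine Finset.sum_le_sum fun i _ => ?_
          have h2 := ih (α + Pi.single i 1) (by rw [msize_add_single]; omega)
          rw [msize_add_single, add_assoc, add_comm 1 j] at h2
          have h3 : |v i| ≤ ‖v‖ := by simpa using PiLp.norm_apply_le v i
          rw [abs_mul]
          refine (mul_le_mul h3 h2 (abs_nonneg _) (norm_nonneg _)).trans (le_of_eq ?_)
          simp only [Finset.mul_sum]
          refine Finset.sum_congr rfl fun β _ => ?_
          ring
        _ = _ := by
          simp [pow_succ]; ring
    · intro i
      refine contDiff_mD _ (hf.of_le ?_)
      rw [msize_add_single]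
      norm_cast; omega

end PartialDerivatives

section Interval

theorem integral_pow_mul_step (n : ℕ) (K : Polynomial ℝ) {v v' : ℝ → ℝ}
    (hv : ∀ t, HasDerivAt v (v' t) t) (hc : Continuous v') :
    ∫ t in (0 : ℝ)..1, t ^ n * (K.eval t * v t) =
      ∫ t in (0 : ℝ)..1, t ^ (n + 1) *
        ((K - Polynomial.C ((n : ℝ) + 1)⁻¹ * ((1 - Polynomial.X) * K).derivative).eval t * v t +
          (-(Polynomial.C ((n : ℝ) + 1)⁻¹ * ((1 - Polynomial.X) * K))).eval t * v' t) := by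
  have hvc : Continuous v := continuous_iff_continuousAt.2 fun t => (hv t).continuousAt
  have hn : (n : ℝ) + 1 ≠ 0 := by positivity
  rw [← sub_eq_zero, ← intervalIntegral.integral_sub]
  rotate_left
  · exact Continuous.intervalIntegrable (by fun_prop) _ _
  · exact Continuous.intervalIntegrable (by fun_prop) _ _
  have hderiv : ∀ t ∈ Set.uIcc (0 : ℝ) 1, HasDerivAt
      (fun t => ((n : ℝ) + 1)⁻¹ * (t ^ (n + 1) * (((1 - Polynomial.X) * K).eval t * v t)))
      (t ^ n * (K.eval t * v t) - t ^ (n + 1) *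
        ((K - Polynomial.C ((n : ℝ) + 1)⁻¹ * ((1 - Polynomial.X) * K).derivative).eval t * v t +
          (-(Polynomial.C ((n : ℝ) + 1)⁻¹ * ((1 - Polynomial.X) * K))).eval t * v' t)) t := by
    intro t _
    have := ((hasDerivAt_pow (n + 1) t).mul
      ((((1 - Polynomial.X) * K).hasDerivAt t).mul (hv t))).const_mul ((n : ℝ) + 1)⁻¹
    refine this.congr_deriv ?_
    simp only [Pi.mul_apply, Polynomial.eval_sub, Polynomial.eval_mul, Polynomial.eval_neg,
      Polynomial.eval_C, Polynomial.eval_one, Polynomial.eval_X, Nat.cast_add, Nat.cast_one, Nat.add_sub_cancel]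
    field_simp
    ring
  rw [intervalIntegral.integral_eq_sub_of_hasDerivAt hderiv
    (Continuous.intervalIntegrable (by fun_prop) _ _)]
  simp

theorem exists_polynomial_kernel (n : ℕ) :
    ∃ K : ℕ → Polynomial ℝ, ∀ U : ℕ → ℝ → ℝ,
      (∀ j < n + 1, ∀ t, HasDerivAt (U j) (U (j + 1) t) t) → Continuous (U (n + 1)) →
      U 0 0 = ∑ j ∈ Finset.range (n + 2), ∫ t in (0 : ℝ)..1, t ^ n * ((K j).eval t * U j t) := by
  induction n with
  | zero =>
    refine ⟨fun j => if j = 0 then 1 else Polynomial.X - 1, fun U hU hc => ?_⟩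
    have hU0 : ∀ t, HasDerivAt (U 0) (U 1 t) t := hU 0 (by norm_num)
    replace hc : Continuous (U 1) := hc
    have hc0 : Continuous (U 0) := continuous_iff_continuousAt.2 fun t => (hU0 t).continuousAt
    have h : ∀ t ∈ Set.uIcc (0 : ℝ) 1, HasDerivAt (fun t => (t - 1) * U 0 t)
        (1 * U 0 t + (t - 1) * U 1 t) t := fun t _ =>
      ((hasDerivAt_id t).sub_const 1).mul (hU0 t)
    have h2 := intervalIntegral.integral_eq_sub_of_hasDerivAt h
      (Continuous.intervalIntegrable (by fun_prop) _ _)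
    rw [intervalIntegral.integral_add (Continuous.intervalIntegrable (by fun_prop) _ _)
      (Continuous.intervalIntegrable (by fun_prop) _ _)] at h2
    simp [Finset.sum_range_succ] at h2 ⊢
    linarith
  | succ n ih =>
    obtain ⟨K, hK⟩ := ih
    let A : ℕ → Polynomial ℝ := fun j => if j < n + 2 then
      K j - Polynomial.C ((n : ℝ) + 1)⁻¹ * ((1 - Polynomial.X) * K j).derivative else 0
    let B : ℕ → Polynomial ℝ := fun j => match j with
      | 0 => 0
      | j + 1 => -(Polynomial.C ((n : ℝ) + 1)⁻¹ * ((1 - Polynomial.X) * K j))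
    refine ⟨fun j => A j + B j, fun U hU hc => ?_⟩
    have hUc : ∀ j ≤ n + 2, Continuous (U j) := fun j hj => by
      rcases hj.lt_or_eq with h | rfl
      · exact continuous_iff_continuousAt.2 fun t => (hU j h t).continuousAt
      · exact hc
    rw [hK U (fun j hj => hU j (by omega)) (hUc _ (by omega))]
    have hA : ∀ j < n + 3, IntervalIntegrable
        (fun t => t ^ (n + 1) * ((A j).eval t * U j t)) volume 0 1 := fun j hj => by
      have := hUc j (by omega)
      exact Continuous.intervalIntegrable (by fun_prop) _ _
    have hB : ∀ j < n + 3, IntervalIntegrable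
        (fun t => t ^ (n + 1) * ((B j).eval t * U j t)) volume 0 1 := fun j hj => by
      have := hUc j (by omega)
      exact Continuous.intervalIntegrable (by fun_prop) _ _
    calc ∑ j ∈ Finset.range (n + 2), ∫ t in (0 : ℝ)..1, t ^ n * ((K j).eval t * U j t)
        = ∑ j ∈ Finset.range (n + 2), ((∫ t in (0 : ℝ)..1, t ^ (n + 1) * ((A j).eval t * U j t)) +
            ∫ t in (0 : ℝ)..1, t ^ (n + 1) * ((B (j + 1)).eval t * U (j + 1) t)) := by
          refine Finset.sum_congr rfl fun j hj => ?_
          have hj' := Finset.mem_range.1 hj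
          rw [integral_pow_mul_step n (K j) (hU j (by omega)) (hUc _ (by omega)),
            ← intervalIntegral.integral_add (hA j (by omega)) (hB (j + 1) (by omega))]
          simp only [A, B, if_pos hj', mul_add]
      _ = (∑ j ∈ Finset.range (n + 3), ∫ t in (0 : ℝ)..1, t ^ (n + 1) * ((A j).eval t * U j t)) +
            ∑ j ∈ Finset.range (n + 3), ∫ t in (0 : ℝ)..1, t ^ (n + 1) * ((B j).eval t * U j t) := by
          rw [Finset.sum_add_distrib]
          congr 1
          · rw [Finset.sum_range_succ _ (n + 2)]
            simp [A]
          · rw [Finset.sum_range_succ' _ (n + 2)]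
            simp [B]
      _ = _ := by
          rw [← Finset.sum_add_distrib]
          refine Finset.sum_congr rfl fun j hj => ?_
          have hj' := Finset.mem_range.1 hj
          rw [← intervalIntegral.integral_add (hA j hj') (hB j hj')]
          simp only [Polynomial.eval_add, add_mul, mul_add]

theorem exists_abs_le_integral_pow_mul_sum (n : ℕ) :
    ∃ C : ℝ, 0 ≤ C ∧ ∀ U : ℕ → ℝ → ℝ,
      (∀ j < n + 1, ∀ t, HasDerivAt (U j) (U (j + 1) t) t) → Continuous (U (n + 1)) →
      |U 0 0| ≤ C * ∫ t in (0 : ℝ)..1, t ^ n * ∑ j ∈ Finset.range (n + 2), |U j t| := by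
  obtain ⟨K, hK⟩ := exists_polynomial_kernel n
  have hb : ∀ j, ∃ c : ℝ, ∀ t ∈ Set.Icc (0 : ℝ) 1, |(K j).eval t| ≤ c := fun j => by
    simpa using isCompact_Icc.exists_bound_of_continuousOn (K j).continuous.continuousOn
  choose c hc using hb
  have hc0 : ∀ j, 0 ≤ c j := fun j => (abs_nonneg _).trans (hc j 0 (by simp))
  refine ⟨∑ j ∈ Finset.range (n + 2), c j, Finset.sum_nonneg fun j _ => hc0 j, fun U hU hUn => ?_⟩
  have hUc : ∀ j ≤ n + 1, Continuous (U j) := fun j hj => by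
    rcases hj.lt_or_eq with h | rfl
    · exact continuous_iff_continuousAt.2 fun t => (hU j h t).continuousAt
    · exact hUn
  have hsum : Continuous fun t => ∑ j ∈ Finset.range (n + 2), |U j t| :=
    continuous_finsetSum _ fun j hj => (hUc j (by have := Finset.mem_range.1 hj; omega)).abs
  rw [hK U hU hUn, Finset.sum_mul]
  refine (Finset.abs_sum_le_sum_abs _ _).trans (Finset.sum_le_sum fun j hj => ?_)
  have hj' := Finset.mem_range.1 hj
  have hUj := hUc j (by omega)
  rw [← intervalIntegral.integral_const_mul]
  refine (intervalIntegral.abs_integral_le_integral_abs zero_le_one).trans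
    (intervalIntegral.integral_mono_on zero_le_one
      (Continuous.intervalIntegrable (by fun_prop) _ _)
      (Continuous.intervalIntegrable (by fun_prop) _ _) fun t ht => ?_)
  rw [abs_mul, abs_mul, abs_of_nonneg (pow_nonneg ht.1 n)]
  have h1 : |U j t| ≤ ∑ j ∈ Finset.range (n + 2), |U j t| :=
    Finset.single_le_sum (f := fun j => |U j t|) (fun _ _ => abs_nonneg _) hj
  have h2 := mul_le_mul (hc j t ht) h1 (abs_nonneg _) (hc0 j)
  calc t ^ n * (|(K j).eval t| * |U j t|) ≤ t ^ n * (c j * ∑ j ∈ Finset.range (n + 2), |U j t|) :=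
        mul_le_mul_of_nonneg_left h2 (pow_nonneg ht.1 n)
    _ = _ := by ring

end Interval

section Averaging

variable {d : ℕ}

theorem setLIntegral_ball_comp_add_smul_le {F : EuclideanSpace ℝ (Fin d) → ℝ≥0∞}
    (hF : Measurable F) (x : EuclideanSpace ℝ (Fin d)) (r : ℝ) {t : ℝ} (ht : 0 < t) (ht1 : t ≤ 1) :
    ∫⁻ v in Metric.ball 0 r, F (x + t • v) ≤
      ENNReal.ofReal (t ^ d)⁻¹ * ∫⁻ y in Metric.ball x r, F y := by
  have hG : Measurable ((Metric.ball x r).indicator F) := hF.indicator measurableSet_ball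
  calc ∫⁻ v in Metric.ball 0 r, F (x + t • v)
      ≤ ∫⁻ v in Metric.ball 0 r, (Metric.ball x r).indicator F (x + t • v) := by
        refine setLIntegral_mono' measurableSet_ball fun v hv => ?_
        have hv' : ‖v‖ < r := by simpa using hv
        rw [Set.indicator_of_mem]
        rw [mem_ball_iff_norm, add_sub_cancel_left, norm_smul, Real.norm_of_nonneg ht.le]
        exact (mul_le_of_le_one_left (norm_nonneg _) ht1).trans_lt hv'
    _ ≤ ∫⁻ v, (Metric.ball x r).indicator F (x + t • v) := setLIntegral_le_lintegral _ _
    _ = ∫⁻ y, (Metric.ball x r).indicator F (x + y) ∂(Measure.map (t • ·) volume) := by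
        rw [lintegral_map (f := fun y => (Metric.ball x r).indicator F (x + y))
          (hG.comp (measurable_const_add x)) (measurable_const_smul t)]
    _ = ENNReal.ofReal (t ^ d)⁻¹ * ∫⁻ y, (Metric.ball x r).indicator F (x + y) := by
        rw [Measure.map_addHaar_smul _ ht.ne', lintegral_smul_measure, finrank_euclideanSpace_fin,
          abs_of_pos (by positivity), smul_eq_mul]
    _ = _ := by
        rw [lintegral_add_left_eq_self, lintegral_indicator measurableSet_ball]

theorem setLIntegral_ball_comp_add_smul_le_Lp {p : ℝ} (hp : 1 < p)
    {G : EuclideanSpace ℝ (Fin d) → ℝ≥0∞} (hG : Measurable G)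
    (x : EuclideanSpace ℝ (Fin d)) (r : ℝ) {t : ℝ} (ht : 0 < t) (ht1 : t ≤ 1) :
    ∫⁻ v in Metric.ball 0 r, G (x + t • v) ≤
      ENNReal.ofReal (t ^ (-((d : ℝ) / p))) *
        ((∫⁻ y in Metric.ball x r, G y ^ p) ^ (1 / p) *
          volume (Metric.ball (0 : EuclideanSpace ℝ (Fin d)) r) ^ (1 - 1 / p)) := by
  have hpq := Real.HolderConjugate.conjExponent hp
  have hp0 : 0 < p := by linarith
  have h := ENNReal.lintegral_mul_le_Lp_mul_Lq
    (volume.restrict (Metric.ball (0 : EuclideanSpace ℝ (Fin d)) r)) hpq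
    (f := fun v => G (x + t • v)) (g := fun _ => 1) (by fun_prop) (by fun_prop)
  have hq : 1 / Real.conjExponent p = 1 - 1 / p := by
    have := hpq.inv_add_inv_eq_one
    simp only [one_div]; linarith
  simp only [Pi.mul_apply, mul_one, ENNReal.one_rpow, lintegral_const, one_mul,
    Measure.restrict_apply_univ, hq] at h
  refine h.trans ?_
  rw [← mul_assoc]
  gcongr
  refine (ENNReal.rpow_le_rpow (setLIntegral_ball_comp_add_smul_le (F := fun y => G y ^ p)
    (by fun_prop) x r ht ht1) (by positivity)).trans (le_of_eq ?_)
  rw [ENNReal.mul_rpow_of_nonneg _ _ (by positivity),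
    ENNReal.ofReal_rpow_of_nonneg (by positivity) (by positivity), ← Real.rpow_natCast,
    ← Real.rpow_neg ht.le, ← Real.rpow_mul ht.le]
  congr 3
  ring

theorem lintegral_ball_lintegral_ray_le {p : ℝ} (hp : 1 < p) {n : ℕ}
    (hn : (d : ℝ) / p < n + 1) {G : EuclideanSpace ℝ (Fin d) → ℝ≥0∞} (hG : Measurable G)
    (x : EuclideanSpace ℝ (Fin d)) (r : ℝ) :
    ∫⁻ v in Metric.ball 0 r, ∫⁻ t in Set.Ioc (0 : ℝ) 1, ENNReal.ofReal (t ^ n) * G (x + t • v) ≤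
      ENNReal.ofReal (n + 1 - (d : ℝ) / p)⁻¹ *
        ((∫⁻ y in Metric.ball x r, G y ^ p) ^ (1 / p) *
          volume (Metric.ball (0 : EuclideanSpace ℝ (Fin d)) r) ^ (1 - 1 / p)) := by
  rw [lintegral_lintegral_swap (by fun_prop)]
  have hI : ∫⁻ t in Set.Ioc (0 : ℝ) 1, ENNReal.ofReal (t ^ ((n : ℝ) - (d : ℝ) / p)) =
      ENNReal.ofReal (n + 1 - (d : ℝ) / p)⁻¹ := by
    have hint : IntervalIntegrable (fun t : ℝ => t ^ ((n : ℝ) - (d : ℝ) / p)) volume 0 1 :=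
      intervalIntegral.intervalIntegrable_rpow' (by linarith)
    rw [← ofReal_integral_eq_lintegral_ofReal
      ((intervalIntegrable_iff_integrableOn_Ioc_of_le zero_le_one).1 hint)
      ((ae_restrict_iff' measurableSet_Ioc).2 (ae_of_all _ fun t ht => Real.rpow_nonneg ht.1.le _)),
      ← intervalIntegral.integral_of_le zero_le_one, integral_rpow (Or.inl (by linarith))]
    rw [Real.one_rpow, Real.zero_rpow (by linarith)]
    congr 1
    rw [sub_zero, one_div]
    congr 1
    ring
  rw [← hI, ← lintegral_mul_const _ (by fun_prop)]
  refine setLIntegral_mono' measurableSet_Ioc fun t ht => ?_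
  rw [lintegral_const_mul _ (by fun_prop)]
  refine (mul_le_mul_right (setLIntegral_ball_comp_add_smul_le_Lp hp hG x r ht.1 ht.2) _).trans
    (le_of_eq ?_)
  rw [← mul_assoc, ← ENNReal.ofReal_mul (pow_nonneg ht.1.le n), ← Real.rpow_natCast,
    ← Real.rpow_add ht.1, ← sub_eq_add_neg]

theorem mul_rpow_le_sum_of_le_integral_ray {ι : Type*} (s : Finset ι) {p : ℝ} (hp : 1 < p) {n : ℕ}
    (hn : (d : ℝ) / p < n + 1) {G : ι → EuclideanSpace ℝ (Fin d) → ℝ}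
    (hG : ∀ i ∈ s, Continuous (G i)) (hG0 : ∀ i y, 0 ≤ G i y) (x : EuclideanSpace ℝ (Fin d))
    {r : ℝ} (hr : 0 < r) {A C : ℝ} (hA : 0 ≤ A) (hC : 0 ≤ C)
    (h : ∀ v : EuclideanSpace ℝ (Fin d), ‖v‖ < r →
      A ≤ C * ∫ t in (0 : ℝ)..1, t ^ n * ∑ i ∈ s, G i (x + t • v)) :
    A * (volume.real (Metric.ball (0 : EuclideanSpace ℝ (Fin d)) r)) ^ (1 / p) ≤
      C * (n + 1 - (d : ℝ) / p)⁻¹ * ∑ i ∈ s, (∫ y in Metric.ball x r, G i y ^ p) ^ (1 / p) := by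
  have hp0 : 0 < p := by linarith
  set V : ℝ := volume.real (Metric.ball (0 : EuclideanSpace ℝ (Fin d)) r) with hV
  have hVe : volume (Metric.ball (0 : EuclideanSpace ℝ (Fin d)) r) = ENNReal.ofReal V := by
    rw [hV, ofReal_measureReal]
  have hV0 : 0 < V := by
    rw [hV, Measure.real, ENNReal.toReal_pos_iff]
    exact ⟨Metric.measure_ball_pos _ _ hr, measure_ball_lt_top⟩
  have hK : 0 < (n + 1 - (d : ℝ) / p)⁻¹ := inv_pos.2 (by linarith)
  set J : ι → ℝ := fun i => ∫ y in Metric.ball x r, G i y ^ p with hJ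
  have hJ0 : ∀ i, 0 ≤ J i := fun i => integral_nonneg fun y => Real.rpow_nonneg (hG0 i y) _
  have hJe : ∀ i ∈ s, ∫⁻ y in Metric.ball x r, ENNReal.ofReal (G i y) ^ p =
      ENNReal.ofReal (J i) := fun i hi => by
    have hc : Continuous fun y => G i y ^ p := (hG i hi).rpow_const fun _ => Or.inr hp0.le
    rw [hJ, ofReal_integral_eq_lintegral_ofReal
      ((hc.continuousOn.integrableOn_compact (isCompact_closedBall x r)).mono_set
        Metric.ball_subset_closedBall) (ae_of_all _ fun y => Real.rpow_nonneg (hG0 i y) _)]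
    simp_rw [ENNReal.ofReal_rpow_of_nonneg (hG0 i _) hp0.le]
  have hpt : ∀ v ∈ Metric.ball (0 : EuclideanSpace ℝ (Fin d)) r, ENNReal.ofReal A ≤
      ENNReal.ofReal C * ∑ i ∈ s, ∫⁻ t in Set.Ioc (0 : ℝ) 1,
        ENNReal.ofReal (t ^ n) * ENNReal.ofReal (G i (x + t • v)) := by
    intro v hv
    refine (ENNReal.ofReal_le_ofReal (h v (by simpa using hv))).trans (le_of_eq ?_)
    rw [ENNReal.ofReal_mul hC, intervalIntegral.integral_of_le zero_le_one,
      ofReal_integral_eq_lintegral_ofReal]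
    · rw [← lintegral_finsetSum' _ fun i hi => ?_]
      · congr 1
        refine setLIntegral_congr_fun measurableSet_Ioc fun t ht => ?_
        rw [ENNReal.ofReal_mul (pow_nonneg ht.1.le n), ENNReal.ofReal_sum_of_nonneg
          fun i _ => hG0 i _, Finset.mul_sum]
      · have := (hG i hi).measurable
        fun_prop
    · have hc : Continuous fun t : ℝ => t ^ n * ∑ i ∈ s, G i (x + t • v) :=
        (continuous_pow n).mul (continuous_finsetSum _ fun i hi => (hG i hi).comp (by fun_prop))
      exact (hc.continuousOn.integrableOn_compact isCompact_Icc).mono_set Set.Ioc_subset_Icc_self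
    · exact (ae_restrict_iff' measurableSet_Ioc).2 (ae_of_all _ fun t ht =>
        mul_nonneg (pow_nonneg ht.1.le n) (Finset.sum_nonneg fun i _ => hG0 i _))
  have hmeas : ∀ i ∈ s, Measurable fun v : EuclideanSpace ℝ (Fin d) =>
      ∫⁻ t in Set.Ioc (0 : ℝ) 1, ENNReal.ofReal (t ^ n) * ENNReal.ofReal (G i (x + t • v)) := by
    intro i hi
    have := (hG i hi).measurable
    exact Measurable.lintegral_prod_right' (f := fun q : EuclideanSpace ℝ (Fin d) × ℝ =>
      ENNReal.ofReal (q.2 ^ n) * ENNReal.ofReal (G i (x + q.2 • q.1))) (by fun_prop)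
  have hint : ENNReal.ofReal A * ENNReal.ofReal V ≤ ENNReal.ofReal C * ∑ i ∈ s,
      ENNReal.ofReal (n + 1 - (d : ℝ) / p)⁻¹ *
        (ENNReal.ofReal (J i) ^ (1 / p) * ENNReal.ofReal V ^ (1 - 1 / p)) := by
    calc ENNReal.ofReal A * ENNReal.ofReal V
        = ∫⁻ _v in Metric.ball (0 : EuclideanSpace ℝ (Fin d)) r, ENNReal.ofReal A := by
          rw [setLIntegral_const, hVe]
      _ ≤ _ := setLIntegral_mono' measurableSet_ball hpt
      _ = ENNReal.ofReal C * ∑ i ∈ s, ∫⁻ v in Metric.ball (0 : EuclideanSpace ℝ (Fin d)) r,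
            ∫⁻ t in Set.Ioc (0 : ℝ) 1,
              ENNReal.ofReal (t ^ n) * ENNReal.ofReal (G i (x + t • v)) := by
          rw [lintegral_const_mul _ (Finset.measurable_fun_sum _ hmeas), lintegral_finsetSum' _
            fun i hi => (hmeas i hi).aemeasurable]
      _ ≤ _ := by
          refine mul_le_mul_right (Finset.sum_le_sum fun i hi => ?_) _
          rw [← hJe i hi, ← hVe]
          exact lintegral_ball_lintegral_ray_le hp hn (G := fun y => ENNReal.ofReal (G i y))
            (hG i hi).measurable.ennreal_ofReal x r
  have hp1 : 0 ≤ 1 - 1 / p := by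
    rw [sub_nonneg, div_le_one hp0]; exact hp.le
  have hterm : ∀ i, ENNReal.ofReal (n + 1 - (d : ℝ) / p)⁻¹ *
        (ENNReal.ofReal (J i) ^ (1 / p) * ENNReal.ofReal V ^ (1 - 1 / p)) =
      ENNReal.ofReal ((n + 1 - (d : ℝ) / p)⁻¹ * (J i ^ (1 / p) * V ^ (1 - 1 / p))) := fun i => by
    rw [ENNReal.ofReal_mul hK.le, ENNReal.ofReal_mul (Real.rpow_nonneg (hJ0 i) _),
      ENNReal.ofReal_rpow_of_nonneg (hJ0 i) (by positivity),
      ENNReal.ofReal_rpow_of_nonneg hV0.le hp1]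
  have hnn : ∀ i, 0 ≤ (n + 1 - (d : ℝ) / p)⁻¹ * (J i ^ (1 / p) * V ^ (1 - 1 / p)) := fun i =>
    mul_nonneg hK.le (mul_nonneg (Real.rpow_nonneg (hJ0 i) _) (Real.rpow_nonneg hV0.le _))
  simp_rw [hterm] at hint
  rw [← ENNReal.ofReal_sum_of_nonneg fun i _ => hnn i, ← ENNReal.ofReal_mul hA,
    ← ENNReal.ofReal_mul hC, ENNReal.ofReal_le_ofReal_iff
      (mul_nonneg hC (Finset.sum_nonneg fun i _ => hnn i))] at hint
  have hVsplit : V = V ^ (1 / p) * V ^ (1 - 1 / p) := by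
    rw [← Real.rpow_add hV0, add_sub_cancel, Real.rpow_one]
  have hVp : 0 < V ^ (1 - 1 / p) := Real.rpow_pos_of_pos hV0 _
  refine le_of_mul_le_mul_right ?_ hVp
  calc A * V ^ (1 / p) * V ^ (1 - 1 / p) = A * V := by rw [mul_assoc, ← hVsplit]
    _ ≤ _ := hint
    _ = _ := by
      simp only [Finset.mul_sum, Finset.sum_mul]
      exact Finset.sum_congr rfl fun i _ => by ring

end Averaging

section JapaneseBracket

variable {d : ℕ}

theorem jb_sq (x : EuclideanSpace ℝ (Fin d)) : jb x ^ 2 = 1 + ‖x‖ ^ 2 :=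
  Real.sq_sqrt (by positivity)

theorem one_le_jb (x : EuclideanSpace ℝ (Fin d)) : 1 ≤ jb x :=
  Real.one_le_sqrt.2 (by nlinarith [norm_nonneg x])

theorem jb_pos (x : EuclideanSpace ℝ (Fin d)) : 0 < jb x :=
  zero_lt_one.trans_le (one_le_jb x)

theorem norm_le_jb (x : EuclideanSpace ℝ (Fin d)) : ‖x‖ ≤ jb x :=
  Real.le_sqrt_of_sq_le (by linarith)

theorem jb_le_one_add_norm (x : EuclideanSpace ℝ (Fin d)) : jb x ≤ 1 + ‖x‖ :=
  Real.sqrt_le_iff.2 ⟨by positivity, by nlinarith [norm_nonneg x]⟩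

theorem continuous_jb : Continuous (jb : EuclideanSpace ℝ (Fin d) → ℝ) := by
  unfold jb
  fun_prop

theorem jb_le_jb_add_norm_sub (x y : EuclideanSpace ℝ (Fin d)) : jb y ≤ jb x + ‖y - x‖ := by
  have h1 := norm_le_jb x
  have h2 : ‖y‖ ≤ ‖x‖ + ‖y - x‖ := by
    simpa using norm_add_le x (y - x)
  have h3 := norm_nonneg (y - x)
  refine Real.sqrt_le_iff.2 ⟨add_nonneg (jb_pos x).le h3, ?_⟩
  have h4 := pow_le_pow_left₀ (norm_nonneg y) h2 2
  nlinarith [jb_sq x, mul_le_mul_of_nonneg_right h1 h3]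

theorem rpow_le_two_rpow_abs_mul_rpow {a b : ℝ} (ha : 0 < a) (hb : 0 < b) (hab : a ≤ 2 * b)
    (hba : b ≤ 2 * a) (e : ℝ) : a ^ e ≤ 2 ^ |e| * b ^ e := by
  rcases le_total 0 e with he | he
  · rw [abs_of_nonneg he, ← Real.mul_rpow zero_le_two hb.le]
    exact Real.rpow_le_rpow ha.le hab he
  · rw [abs_of_nonpos he, Real.rpow_neg zero_le_two, ← Real.inv_rpow zero_le_two,
      ← Real.mul_rpow (by norm_num) hb.le]
    exact Real.rpow_le_rpow_of_nonpos (by positivity) (by linarith) he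

end JapaneseBracket

section WeightedMorrey

variable {d : ℕ}

theorem hasDerivAt_iterate_dirDeriv_line {n j : ℕ} (hj : j < n)
    {g : EuclideanSpace ℝ (Fin d) → ℝ} (hg : ContDiff ℝ n g) (x v : EuclideanSpace ℝ (Fin d))
    (t : ℝ) :
    HasDerivAt (fun t : ℝ => (dirDeriv v)^[j] g (x + t • v))
      ((dirDeriv v)^[j + 1] g (x + t • v)) t := by
  have h1 : ContDiff ℝ (1 : ℕ) ((dirDeriv v)^[j] g) :=
    contDiff_iterate_dirDeriv v j (hg.of_le (by norm_cast; omega))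
  have h2 := (h1.differentiable (by simp) (x + t • v)).hasFDerivAt
  have h3 : HasDerivAt (fun t : ℝ => x + t • v) v t := by
    simpa using ((hasDerivAt_id t).smul_const v).const_add x
  rw [Function.iterate_succ_apply']
  exact h2.comp_hasDerivAt t h3

theorem rpow_jb_mul_abs_iterate_dirDeriv_mD_le {m : ℕ} (s : ℝ)
    {f : EuclideanSpace ℝ (Fin d) → ℝ} (hf : ContDiff ℝ m f)
    {x y v : EuclideanSpace ℝ (Fin d)} (hv : ‖v‖ ≤ jb x) (hxy : jb x ≤ 2 * jb y)
    (hyx : jb y ≤ 2 * jb x) {j : ℕ} {α : Fin d → ℕ} (hα : msize α + j ≤ m) :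
    jb x ^ (s + msize α) * |(dirDeriv v)^[j] (mD α f) y| ≤
      (d : ℝ) ^ j * 2 ^ (|s| + m) * ∑ β ∈ mIdx d m, jb y ^ (s + msize β) * |mD β f y| := by
  have hx := jb_pos x
  calc jb x ^ (s + msize α) * |(dirDeriv v)^[j] (mD α f) y|
      ≤ jb x ^ (s + msize α) * ((d : ℝ) ^ j *
          ∑ β ∈ mIdx d m with msize β = msize α + j, ‖v‖ ^ j * |mD β f y|) :=
        mul_le_mul_of_nonneg_left (abs_iterate_dirDeriv_mD_le hf v y j α hα)
          (Real.rpow_nonneg hx.le _)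
    _ = (d : ℝ) ^ j * ∑ β ∈ mIdx d m with msize β = msize α + j,
          jb x ^ (s + msize α) * ‖v‖ ^ j * |mD β f y| := by
        rw [mul_left_comm, Finset.mul_sum (a := jb x ^ _)]
        simp_rw [mul_assoc]
    _ ≤ (d : ℝ) ^ j * ∑ β ∈ mIdx d m with msize β = msize α + j,
          2 ^ (|s| + m) * (jb y ^ (s + msize β) * |mD β f y|) := by
        refine mul_le_mul_of_nonneg_left (Finset.sum_le_sum fun β hβ => ?_) (by positivity)
        obtain ⟨hβm, hβ⟩ := Finset.mem_filter.1 hβ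
        have hβm : (msize β : ℝ) ≤ m := by exact_mod_cast mem_mIdx.1 hβm
        rw [← mul_assoc]
        refine mul_le_mul_of_nonneg_right ?_ (abs_nonneg _)
        calc jb x ^ (s + msize α) * ‖v‖ ^ j ≤ jb x ^ (s + msize α) * jb x ^ j := by
              gcongr
          _ = jb x ^ (s + msize β) := by
              rw [← Real.rpow_natCast, ← Real.rpow_add hx, hβ]
              push_cast
              rw [add_assoc]
          _ ≤ 2 ^ |s + msize β| * jb y ^ (s + msize β) :=
              rpow_le_two_rpow_abs_mul_rpow hx (jb_pos y) hxy hyx _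
          _ ≤ _ := by
              refine mul_le_mul_of_nonneg_right ?_ (Real.rpow_nonneg (jb_pos y).le _)
              refine Real.rpow_le_rpow_of_exponent_le one_le_two ?_
              refine (abs_add_le _ _).trans ?_
              rw [Nat.abs_cast]
              linarith
    _ ≤ _ := by
        rw [← Finset.mul_sum, ← mul_assoc]
        refine mul_le_mul_of_nonneg_left (Finset.sum_le_sum_of_subset_of_nonneg
          (Finset.filter_subset _ _) fun β _ _ => ?_) (by positivity)
        exact mul_nonneg (Real.rpow_nonneg (jb_pos y).le _) (abs_nonneg _)

theorem continuous_rpow_jb_mul_abs_mD {m : ℕ} {f : EuclideanSpace ℝ (Fin d) → ℝ}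
    (hf : ContDiff ℝ m f) (s : ℝ) {β : Fin d → ℕ} (hβ : β ∈ mIdx d m) :
    Continuous fun y => jb y ^ s * |mD β f y| := by
  have h : ContDiff ℝ (0 : ℕ) (mD β f) :=
    contDiff_mD β (hf.of_le (by have := mem_mIdx.1 hβ; norm_cast; omega))
  exact (continuous_jb.rpow_const fun y => Or.inl (jb_pos y).ne').mul h.continuous.abs

theorem exists_rpow_jb_mul_abs_mD_le_integral_ray (m n : ℕ) (s : ℝ) {α : Fin d → ℕ}
    (hα : msize α + (n + 1) = m) :
    ∃ C : ℝ, 0 ≤ C ∧ ∀ f : EuclideanSpace ℝ (Fin d) → ℝ, ContDiff ℝ m f →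
      ∀ x v : EuclideanSpace ℝ (Fin d), ‖v‖ < jb x / 2 →
        jb x ^ (s + msize α) * |mD α f x| ≤ C * ∫ t in (0 : ℝ)..1, t ^ n *
          ∑ β ∈ mIdx d m, jb (x + t • v) ^ (s + msize β) * |mD β f (x + t • v)| := by
  obtain ⟨C, hC, h⟩ := exists_abs_le_integral_pow_mul_sum n
  set D : ℝ := ∑ j ∈ Finset.range (n + 2), (d : ℝ) ^ j * 2 ^ (|s| + m)
  refine ⟨C * D, mul_nonneg hC (Finset.sum_nonneg fun _ _ => by positivity),
    fun f hf x v hv => ?_⟩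
  have hg : ContDiff ℝ (n + 1 : ℕ) (mD α f) :=
    contDiff_mD α (hf.of_le (by norm_cast; omega))
  have hcont : ∀ j ≤ n + 1, Continuous fun t : ℝ => (dirDeriv v)^[j] (mD α f) (x + t • v) :=
    fun j hj => (contDiff_iterate_dirDeriv (n := 0) v j
      (hg.of_le (by norm_cast; omega))).continuous.comp (by fun_prop)
  have key := h (fun j t => (dirDeriv v)^[j] (mD α f) (x + t • v))
    (fun j hj t => hasDerivAt_iterate_dirDeriv_line hj hg x v t) (hcont _ le_rfl)
  simp only [Function.iterate_zero, id_eq, zero_smul, add_zero] at key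
  have hpos : 0 ≤ jb x ^ (s + msize α) := Real.rpow_nonneg (jb_pos x).le _
  refine (mul_le_mul_of_nonneg_left key hpos).trans ?_
  rw [mul_left_comm, mul_assoc C]
  refine mul_le_mul_of_nonneg_left ?_ hC
  rw [← intervalIntegral.integral_const_mul, ← intervalIntegral.integral_const_mul]
  have hc1 : Continuous fun t : ℝ => ∑ j ∈ Finset.range (n + 2),
      |(dirDeriv v)^[j] (mD α f) (x + t • v)| := continuous_finsetSum _ fun j hj =>
    (hcont j (by have := Finset.mem_range.1 hj; omega)).abs
  have hc2 : Continuous fun t : ℝ => ∑ β ∈ mIdx d m,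
      jb (x + t • v) ^ (s + msize β) * |mD β f (x + t • v)| := continuous_finsetSum _ fun β hβ =>
    (continuous_rpow_jb_mul_abs_mD hf _ hβ).comp (by fun_prop : Continuous fun t : ℝ => x + t • v)
  refine intervalIntegral.integral_mono_on zero_le_one
    (Continuous.intervalIntegrable (by fun_prop) _ _)
    (Continuous.intervalIntegrable (by fun_prop) _ _) fun t ht => ?_
  rw [mul_left_comm, mul_left_comm D]
  refine mul_le_mul_of_nonneg_left ?_ (pow_nonneg ht.1 n)
  rw [Finset.mul_sum, Finset.sum_mul]
  have htv : ‖t • v‖ ≤ jb x / 2 := by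
    rw [norm_smul, Real.norm_of_nonneg ht.1]
    exact (mul_le_of_le_one_left (norm_nonneg _) ht.2).trans hv.le
  have hx := jb_pos x
  have h1 := jb_le_jb_add_norm_sub x (x + t • v)
  have h2 := jb_le_jb_add_norm_sub (x + t • v) x
  rw [add_sub_cancel_left] at h1
  rw [sub_add_cancel_left, norm_neg] at h2
  refine Finset.sum_le_sum fun j hj => ?_
  have hj' := Finset.mem_range.1 hj
  exact rpow_jb_mul_abs_iterate_dirDeriv_mD_le s hf (by linarith) (by linarith) (by linarith)
    (by omega)

theorem exists_rpow_jb_mul_abs_mD_le_sum_setIntegral (m : ℕ) {p : ℝ} (hp : 1 < p) (δ : ℝ)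
    {α : Fin d → ℕ} (hα : (msize α : ℝ) < m - (d : ℝ) / p) :
    ∃ C : ℝ, 0 ≤ C ∧ ∀ f : EuclideanSpace ℝ (Fin d) → ℝ, ContDiff ℝ m f →
      ∀ x, jb x ^ (δ + msize α) * |mD α f x| ≤ C * ∑ β ∈ mIdx d m,
        (∫ y in Metric.ball x (jb x / 2),
          (jb y ^ (δ - (d : ℝ) / p + msize β) * |mD β f y|) ^ p) ^ (1 / p) := by
  have hp0 : 0 < p := by linarith
  have hdp : 0 ≤ (d : ℝ) / p := by positivity
  have hlt : msize α < m := by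
    have : (msize α : ℝ) < m := by linarith
    exact_mod_cast this
  obtain ⟨n, hn⟩ : ∃ n, msize α + (n + 1) = m := ⟨m - msize α - 1, by omega⟩
  have hnd : (d : ℝ) / p < n + 1 := by
    have : (msize α : ℝ) + (n + 1) = m := by exact_mod_cast hn
    linarith
  obtain ⟨C, hC, h⟩ := exists_rpow_jb_mul_abs_mD_le_integral_ray m n (δ - (d : ℝ) / p) hn
  set V : ℝ := volume.real (Metric.ball (0 : EuclideanSpace ℝ (Fin d)) (1 / 2)) with hV
  have hV0 : 0 < V := by
    rw [hV, Measure.real, ENNReal.toReal_pos_iff]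
    exact ⟨Metric.measure_ball_pos _ _ (by norm_num), measure_ball_lt_top⟩
  have hVp : 0 < V ^ (1 / p) := Real.rpow_pos_of_pos hV0 _
  have hK : 0 < (n + 1 - (d : ℝ) / p)⁻¹ := inv_pos.2 (by linarith)
  refine ⟨C * (n + 1 - (d : ℝ) / p)⁻¹ / V ^ (1 / p), by positivity, fun f hf x => ?_⟩
  have hx := jb_pos x
  have hmain := mul_rpow_le_sum_of_le_integral_ray (mIdx d m) hp hnd
    (G := fun β y => jb y ^ (δ - (d : ℝ) / p + msize β) * |mD β f y|)
    (fun β hβ => continuous_rpow_jb_mul_abs_mD hf _ hβ)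
    (fun β y => mul_nonneg (Real.rpow_nonneg (jb_pos y).le _) (abs_nonneg _)) x (half_pos hx)
    (mul_nonneg (Real.rpow_nonneg hx.le _) (abs_nonneg _)) hC (h f hf x)
  have hvol : volume.real (Metric.ball (0 : EuclideanSpace ℝ (Fin d)) (jb x / 2)) =
      jb x ^ d * V := by
    rw [hV, Measure.real, div_eq_mul_one_div (jb x) 2, Measure.addHaar_ball_mul_of_pos _ _ hx,
      ENNReal.toReal_mul, ENNReal.toReal_ofReal (by positivity), finrank_euclideanSpace_fin]
    rfl
  rw [hvol, Real.mul_rpow (by positivity) hV0.le, ← Real.rpow_natCast, ← Real.rpow_mul hx.le,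
    ← mul_assoc, mul_right_comm (jb x ^ _), ← Real.rpow_add hx] at hmain
  rw [div_mul_eq_mul_div, le_div_iff₀ hVp]
  have hexp : δ - (d : ℝ) / p + msize α + d * (1 / p) = δ + msize α := by ring
  rwa [hexp] at hmain

theorem tendsto_setIntegral_ball_half_jb {g : EuclideanSpace ℝ (Fin d) → ℝ}
    (hg : Integrable g) :
    Tendsto (fun x => ∫ y in Metric.ball x (jb x / 2), g y)
      (cocompact (EuclideanSpace ℝ (Fin d))) (𝓝 0) := by
  have hgen : (cocompact (EuclideanSpace ℝ (Fin d))).IsCountablyGenerated := by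
    rw [← Metric.cobounded_eq_cocompact, ← comap_norm_atTop]
    infer_instance
  simp_rw [← integral_indicator measurableSet_ball]
  rw [← integral_zero (EuclideanSpace ℝ (Fin d)) ℝ (μ := volume)]
  refine tendsto_integral_filter_of_dominated_convergence (fun y => ‖g y‖)
    (Eventually.of_forall fun x => hg.aestronglyMeasurable.indicator measurableSet_ball)
    (Eventually.of_forall fun x => ae_of_all _ fun y => norm_indicator_le_norm_self _ _)
    hg.norm (ae_of_all _ fun y => tendsto_const_nhds.congr' ?_)
  filter_upwards [(tendsto_norm_cocompact_atTop (E := EuclideanSpace ℝ (Fin d))).eventually_ge_atTop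
    (1 + 2 * ‖y‖)] with x hx
  rw [Set.indicator_of_notMem]
  rw [mem_ball_iff_norm', not_lt]
  have h1 := jb_le_one_add_norm x
  have h2 := norm_sub_norm_le x y
  linarith

end WeightedMorrey

/-- Weighted Morrey-type estimate for `W^{m,p}_δ(ℝ^d)`: if `mp > d` and
`k < m - d/p`, then for `f ∈ C^m` with finite `W^{m,p}_{δ-d/p}` norm and any multi-index
`α` with `|α| ≤ k`, one has `sup_x ⟨x⟩^{δ+|α|} |D^α f(x)| ≤ C ‖f‖_{W^{m,p}_{δ-d/p}}` and
`|x|^{δ+|α|} |D^α f(x)| → 0` as `|x| → ∞`. -/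
theorem weighted_W_morrey_inequality
    (d m k : ℕ) (hd : 1 ≤ d) (p δ : ℝ) (hp : 1 < p)
    (hmp : (d : ℝ) < (m : ℝ) * p) (hk : (k : ℝ) < (m : ℝ) - (d : ℝ) / p) :
    ∃ C : ℝ, 0 < C ∧ ∀ f : EuclideanSpace ℝ (Fin d) → ℝ,
      ContDiff ℝ m f →
      (∀ β ∈ mIdx d m,
        Integrable (fun x => (jb x ^ (δ - (d : ℝ) / p + (msize β : ℝ)) * |mD β f x|) ^ p)) →
      ∀ α ∈ mIdx d k,
        (∀ x, jb x ^ (δ + (msize α : ℝ)) * |mD α f x| ≤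
          C * ∑ β ∈ mIdx d m,
            (∫ x, (jb x ^ (δ - (d : ℝ) / p + (msize β : ℝ)) * |mD β f x|) ^ p) ^ (1 / p)) ∧
        Tendsto (fun x : EuclideanSpace ℝ (Fin d) => ‖x‖ ^ (δ + (msize α : ℝ)) * |mD α f x|)
          (cocompact (EuclideanSpace ℝ (Fin d))) (𝓝 0) := by
  have hp0 : 0 < p := by linarith
  have hα : ∀ α : Fin d → ℕ, α ∈ mIdx d k → (msize α : ℝ) < m - (d : ℝ) / p := fun α h => by
    have : (msize α : ℝ) ≤ k := by exact_mod_cast mem_mIdx.1 h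
    linarith
  choose! C hC0 hC using fun α h =>
    exists_rpow_jb_mul_abs_mD_le_sum_setIntegral (d := d) m hp δ (hα α h)
  refine ⟨∑ α ∈ mIdx d k, C α + 1, add_pos_of_nonneg_of_pos (Finset.sum_nonneg hC0) one_pos,
    fun f hf hint α hαk => ⟨fun x => ?_, ?_⟩⟩
  · have hnn : ∀ (β : Fin d → ℕ) (y : EuclideanSpace ℝ (Fin d)),
        0 ≤ (jb y ^ (δ - (d : ℝ) / p + (msize β : ℝ)) * |mD β f y|) ^ p := fun β y =>
      Real.rpow_nonneg (mul_nonneg (Real.rpow_nonneg (jb_pos y).le _) (abs_nonneg _)) _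
    refine (hC α hαk f hf x).trans (mul_le_mul ?_ (Finset.sum_le_sum fun β hβ => ?_) ?_ ?_)
    · exact (Finset.single_le_sum hC0 hαk).trans (le_add_of_nonneg_right zero_le_one)
    · exact Real.rpow_le_rpow (integral_nonneg (hnn β))
        (setIntegral_le_integral (hint β hβ) (ae_of_all _ (hnn β))) (by positivity)
    · exact Finset.sum_nonneg fun β _ => Real.rpow_nonneg (integral_nonneg (hnn β)) _
    · exact add_nonneg (Finset.sum_nonneg hC0) zero_le_one
  · have hlim : Tendsto (fun x => 2 ^ |δ + msize α| * (C α * ∑ β ∈ mIdx d m,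
        (∫ y in Metric.ball x (jb x / 2),
          (jb y ^ (δ - (d : ℝ) / p + msize β) * |mD β f y|) ^ p) ^ (1 / p)))
        (cocompact (EuclideanSpace ℝ (Fin d))) (𝓝 0) := by
      have hβ : ∀ β ∈ mIdx d m, Tendsto (fun x => (∫ y in Metric.ball x (jb x / 2),
          (jb y ^ (δ - (d : ℝ) / p + msize β) * |mD β f y|) ^ p) ^ (1 / p))
          (cocompact (EuclideanSpace ℝ (Fin d))) (𝓝 0) := fun β hβ => by
        have h1 := (tendsto_setIntegral_ball_half_jb (hint β hβ)).rpow_const (p := 1 / p)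
          (Or.inr (by positivity))
        rwa [Real.zero_rpow (by positivity)] at h1
      simpa using ((tendsto_finsetSum _ hβ).const_mul (C α)).const_mul (2 ^ |δ + msize α|)
    refine squeeze_zero' (Eventually.of_forall fun x =>
      mul_nonneg (Real.rpow_nonneg (norm_nonneg x) _) (abs_nonneg _)) ?_ hlim
    filter_upwards [(tendsto_norm_cocompact_atTop
      (E := EuclideanSpace ℝ (Fin d))).eventually_ge_atTop 1] with x hx
    refine le_trans ?_ (mul_le_mul_of_nonneg_left (hC α hαk f hf x) (by positivity))
    rw [← mul_assoc]
    refine mul_le_mul_of_nonneg_right (rpow_le_two_rpow_abs_mul_rpow (by linarith) (jb_pos x)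
      ?_ ?_ _) (abs_nonneg _)
    · linarith [norm_le_jb x, jb_pos x]
    · linarith [jb_le_one_add_norm x]
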